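/- Let M be a structure over a relational signature that is saturated (i.e., |M|-saturated) and whose cardinality κ satisfies κ = κ^ω. Then M has the homomorphism lifting property. -/

import Mathlib

open FirstOrder FirstOrder.Language Cardinal

universe u v w

namespace PaperCSP

variable {L : FirstOrder.Language.{u, v}}

/-- Primitive positive bounded formulas: built from `⊥`, equalities and atomic relations
using conjunction and existential quantification. -/
inductive IsPP {α : Type w} : ∀ {n : ℕ}, L.BoundedFormula α n → Prop
  | falsum {n} : IsPP (BoundedFormula.falsum : L.BoundedFormula α n)
  | equal {n} (t₁ t₂ : L.Term (α ⊕ Fin n)) : IsPP (BoundedFormula.equal t₁ t₂)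
  | rel {n ℓ} (R : L.Relations ℓ) (ts : Fin ℓ → L.Term (α ⊕ Fin n)) :
      IsPP (BoundedFormula.rel R ts)
  | inf {n} {φ ψ : L.BoundedFormula α n} : IsPP φ → IsPP ψ → IsPP (φ ⊓ ψ)
  | ex {n} {φ : L.BoundedFormula α (n + 1)} : IsPP φ → IsPP φ.ex

/-- Existential positive bounded formulas: additionally closed under disjunction. -/
inductive IsEP {α : Type w} : ∀ {n : ℕ}, L.BoundedFormula α n → Prop
  | falsum {n} : IsEP (BoundedFormula.falsum : L.BoundedFormula α n)
  | equal {n} (t₁ t₂ : L.Term (α ⊕ Fin n)) : IsEP (BoundedFormula.equal t₁ t₂)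
  | rel {n ℓ} (R : L.Relations ℓ) (ts : Fin ℓ → L.Term (α ⊕ Fin n)) :
      IsEP (BoundedFormula.rel R ts)
  | inf {n} {φ ψ : L.BoundedFormula α n} : IsEP φ → IsEP ψ → IsEP (φ ⊓ ψ)
  | sup {n} {φ ψ : L.BoundedFormula α n} : IsEP φ → IsEP ψ → IsEP (φ ⊔ ψ)
  | ex {n} {φ : L.BoundedFormula α (n + 1)} : IsEP φ → IsEP φ.ex

/-- A relation is pp-definable (without parameters) in a structure. -/
def PPDefinable (L : FirstOrder.Language.{u, v}) (A : Type w) [L.Structure A] {m : ℕ} (R : Set ((Fin m) → A)) : Prop :=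
  ∃ φ : L.Formula (Fin m), IsPP φ ∧ R = {x | φ.Realize x}

/-- A relation is ep-definable (without parameters) in a structure. -/
def EPDefinable (L : FirstOrder.Language.{u, v}) (A : Type w) [L.Structure A] {m : ℕ} (R : Set ((Fin m) → A)) : Prop :=
  ∃ φ : L.Formula (Fin m), IsEP φ ∧ R = {x | φ.Realize x}

/-- A relation is first-order definable (without parameters) in a structure. -/
def FODefinable (L : FirstOrder.Language.{u, v}) (A : Type w) [L.Structure A] {m : ℕ} (R : Set ((Fin m) → A)) : Prop :=
  ∃ φ : L.Formula (Fin m), R = {x | φ.Realize x}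

/-- The direct power structure on `I → A`: relations hold iff they hold component-wise. -/
instance piStructure (I : Type*) (A : Type w) [L.Structure A] : L.Structure (I → A) where
  funMap f x i := Structure.funMap f fun j => x j i
  RelMap r x := ∀ i, Structure.RelMap r fun j => x j i

/-- An `m`-ary relation `R` on `A` is preserved by (invariant under) a function
`f : A^I → A` if it is preserved component-wise. -/
def Preserves {A : Type w} {I : Type*} (f : (I → A) → A)
    {m : ℕ} (R : Set (Fin m → A)) : Prop :=
  ∀ a : Fin m → I → A, (∀ i : I, (fun j => a j i) ∈ R) → (fun j => f (a j)) ∈ R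

/-- `R` is preserved by all ω-polymorphisms (homomorphisms `A^κ → A`, `κ ≤ ω`). -/
def PreservedByOmegaPolymorphisms (L : FirstOrder.Language.{u, v}) (A : Type w) [L.Structure A] {m : ℕ}
    (R : Set (Fin m → A)) : Prop :=
  ∀ (I : Type) [Countable I] (f : (I → A) →[L] A), Preserves (f : (I → A) → A) R

/-- The primitive positive theory of a structure: all true pp-sentences together with
the negations of all false pp-sentences. -/
def ppTheory (L : FirstOrder.Language.{u, v}) (A : Type w) [L.Structure A] : L.Theory :=
  {σ | IsPP σ ∧ A ⊨ σ} ∪ {σ | ∃ φ : L.Sentence, IsPP φ ∧ ¬A ⊨ φ ∧ σ = φ.not}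

/-- `A` is an existential-positively closed (epc) model of `T`. -/
def IsEPC (T : L.Theory) (A : Type w) [L.Structure A] : Prop :=
  A ⊨ T ∧ ∀ (B : Type w) [L.Structure B], B ⊨ T →
    ∀ (h : A →[L] B) (k : ℕ) (φ : L.Formula (Fin k)), IsPP φ →
      ∀ a : Fin k → A, φ.Realize (fun i => h (a i)) → φ.Realize a

/-- A structure is a core if every endomorphism is an embedding. -/
def IsCore (L : FirstOrder.Language.{u, v}) (A : Type w) [L.Structure A] : Prop :=
  ∀ h : A →[L] A, Function.Injective h ∧
    ∀ {n : ℕ} (r : L.Relations n) (x : Fin n → A),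
      Structure.RelMap r (fun i => h (x i)) → Structure.RelMap r x

/-- A set of formulas in `n` free variables is satisfiable together with the theory `T`. -/
def SatWith (T : L.Theory) {n : ℕ} (Φ : Set (L.Formula (Fin n))) : Prop :=
  ∃ (N : Type (max u v)) (S : L.Structure N), letI := S
    Nonempty N ∧ N ⊨ T ∧ ∃ b : Fin n → N, ∀ φ ∈ Φ, φ.Realize b

/-- A pp-`n`-type of a theory `T`. -/
def IsPPType (T : L.Theory) {n : ℕ} (p : Set (L.Formula (Fin n))) : Prop :=
  (∀ φ ∈ p, IsPP φ) ∧ SatWith T p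

/-- A maximal pp-`n`-type of a theory `T`. -/
def IsMaximalPPType (T : L.Theory) {n : ℕ} (p : Set (L.Formula (Fin n))) : Prop :=
  IsPPType T p ∧ ∀ φ : L.Formula (Fin n), IsPP φ → φ ∉ p → ¬SatWith T (insert φ p)

/-- `B` is pp-`κ`-saturated: over any set of fewer than `κ` parameters, every set of
pp-formulas in one free variable all of whose finite subsets are realised (i.e. every
pp-1-type of the expansion) is realised. -/
def IsPPSaturated (L : FirstOrder.Language.{u, v}) (κ : Cardinal.{w}) (B : Type w) [L.Structure B] : Prop :=
  ∀ (β : Type w), #β < κ → ∀ (v : β → B) (p : Set (L.Formula (β ⊕ Unit))),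
    (∀ φ ∈ p, IsPP φ) →
    (∀ s : Finset (L.Formula (β ⊕ Unit)), ↑s ⊆ p →
        ∃ c : B, ∀ φ ∈ s, Formula.Realize φ (Sum.elim v fun _ => c)) →
    ∃ c : B, ∀ φ ∈ p, Formula.Realize φ (Sum.elim v fun _ => c)

/-- `B` is `κ`-saturated: over any set of fewer than `κ` parameters, every set of
formulas in one free variable all of whose finite subsets are realised (i.e. every
1-type of the expansion) is realised. -/
def IsSaturated (L : FirstOrder.Language.{u, v}) (κ : Cardinal.{w}) (B : Type w) [L.Structure B] : Prop :=
  ∀ (β : Type w), #β < κ → ∀ (v : β → B) (p : Set (L.Formula (β ⊕ Unit))),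
    (∀ s : Finset (L.Formula (β ⊕ Unit)), ↑s ⊆ p →
        ∃ c : B, ∀ φ ∈ s, Formula.Realize φ (Sum.elim v fun _ => c)) →
    ∃ c : B, ∀ φ ∈ p, Formula.Realize φ (Sum.elim v fun _ => c)

/-- The homomorphism lifting property. -/
def HomLifting (L : FirstOrder.Language.{u, v}) (M : Type w) [L.Structure M] : Prop :=
  ∀ (k : ℕ) (a : Fin k → (ℕ → M)) (b : Fin k → M),
    (∀ φ : L.Formula (Fin k), IsPP φ →
        Formula.Realize (M := ℕ → M) φ a → Formula.Realize φ b) →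
    ∃ f : (ℕ → M) →[L] M, ∀ i, f (a i) = b i

/-- A function `f : A^α → A` is essentially unary. -/
def EssentiallyUnary {A : Type w} {α : Type*} (f : (α → A) → A) : Prop :=
  ∃ (β : α) (g : A → A), ∀ x : α → A, f x = g (x β)



section Helpers

theorem IsPP.castLE {α : Type w} {m : ℕ} {φ : L.BoundedFormula α m} (h : IsPP φ) :
    ∀ {n : ℕ} (hmn : m ≤ n), IsPP (φ.castLE hmn) := by
  induction h with
  | falsum => intro n _; exact IsPP.falsum
  | equal t₁ t₂ => intro n _; exact IsPP.equal _ _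
  | rel R ts => intro n _; exact IsPP.rel _ _
  | inf _ _ ih1 ih2 => intro n hmn; exact IsPP.inf (ih1 hmn) (ih2 hmn)
  | ex _ ih => intro n hmn; exact IsPP.ex (ih (Nat.succ_le_succ hmn))

theorem IsPP.relabel {α : Type*} {β : Type*} {n m : ℕ} (g : α → β ⊕ Fin n)
    {φ : L.BoundedFormula α m} (h : IsPP φ) : IsPP (φ.relabel g) := by
  induction h with
  | falsum => exact IsPP.falsum
  | equal t₁ t₂ => exact IsPP.equal _ _
  | rel R ts => exact IsPP.rel _ _
  | inf _ _ ih1 ih2 => exact IsPP.inf ih1 ih2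
  | ex _ ih => rw [BoundedFormula.relabel_ex]; exact IsPP.ex ih

theorem IsPP.restrictFreeVar {α : Type*} {β : Type*} [DecidableEq α] {m : ℕ}
    {φ : L.BoundedFormula α m} (h : IsPP φ) :
    ∀ f : φ.freeVarFinset → β, IsPP (φ.restrictFreeVar f) := by
  induction h with
  | falsum => intro f; exact IsPP.falsum
  | equal t₁ t₂ => intro f; exact IsPP.equal _ _
  | rel R ts => intro f; exact IsPP.rel _ _
  | inf _ _ ih1 ih2 => intro f; exact IsPP.inf (ih1 _) (ih2 _)
  | ex _ ih => intro f; exact IsPP.ex (ih _)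

variable {N M : Type w} [L.Structure N] [L.Structure M]

/-- A set of pairs is pp-preserving. -/
def PPR (L : FirstOrder.Language.{u, v}) {N M : Type w} [L.Structure N] [L.Structure M]
    (R : Set (N × M)) : Prop :=
  ∀ φ : L.Formula R, IsPP φ → φ.Realize (fun r => r.1.1) → φ.Realize (fun r => r.1.2)

theorem PPR.mono {R S : Set (N × M)} (h : PPR L S) (hRS : R ⊆ S) : PPR L R := by
  intro φ hφ hr
  have := h (φ.relabel (Set.inclusion hRS)) (IsPP.relabel _ hφ)
  rw [Formula.realize_relabel, Formula.realize_relabel] at this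
  exact this hr

theorem PPR.of_finite {R : Set (N × M)}
    (h : ∀ F : Finset (N × M), (F : Set (N × M)) ⊆ R → PPR L (F : Set (N × M))) : PPR L R := by
  classical
  intro φ hφ hr
  let F : Finset (N × M) := φ.freeVarFinset.image Subtype.val
  have hF : (F : Set (N × M)) ⊆ R := by
    intro x hx
    simp only [F, Finset.coe_image, Set.mem_image] at hx
    obtain ⟨y, _, rfl⟩ := hx
    exact y.2
  let f : φ.freeVarFinset → (F : Set (N × M)) :=
    fun x => ⟨x.1.1, Finset.mem_coe.2 (Finset.mem_image_of_mem _ x.2)⟩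
  have key := h F hF (φ.restrictFreeVar f) (hφ.restrictFreeVar f)
  have h1 := BoundedFormula.realize_restrictFreeVar (φ := φ) (f := f) (xs := default)
    (v := fun r => r.1.1) (fun r : R => r.1.1) (fun _ => rfl)
  have h2 := BoundedFormula.realize_restrictFreeVar (φ := φ) (f := f) (xs := default)
    (v := fun r => r.1.2) (fun r : R => r.1.2) (fun _ => rfl)
  exact h2.1 (key (h1.2 hr))

theorem exists_conj {α : Type w} (a : α) (s : Finset (L.Formula α)) (hs : ∀ φ ∈ s, IsPP φ) :
    ∃ ψ : L.Formula α, IsPP ψ ∧ ∀ (A : Type w) [L.Structure A] (v : α → A),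
      ψ.Realize v ↔ ∀ φ ∈ s, φ.Realize v := by
  classical
  induction s using Finset.induction_on with
  | empty =>
    refine ⟨BoundedFormula.equal (Term.var (Sum.inl a)) (Term.var (Sum.inl a)),
      IsPP.equal _ _, ?_⟩
    intro A _ v
    simp [Formula.Realize, BoundedFormula.Realize]
  | insert φ s _ ih =>
    obtain ⟨ψ, hψ, hr⟩ := ih (fun χ hχ => hs χ (Finset.mem_insert_of_mem hχ))
    refine ⟨φ ⊓ ψ, IsPP.inf (hs φ (Finset.mem_insert_self _ _)) hψ, ?_⟩
    intro A _ v
    rw [Formula.realize_inf, hr A v, Finset.forall_mem_insert]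

theorem PPR.extend {R : Set (N × M)} (hsat : IsSaturated L (#M) M) (hR : #R < #M)
    (h : PPR L R) (n : N) : ∃ m : M, PPR L (insert (n, m) R) := by
  classical
  let p : Set (L.Formula (R ⊕ Unit)) :=
    {φ | IsPP φ ∧ φ.Realize (Sum.elim (fun r : R => r.1.1) fun _ => n)}
  obtain ⟨m, hm⟩ := hsat R hR (fun r => r.1.2) p (by
    intro s hs
    obtain ⟨ψ, hψ, hr⟩ := exists_conj (Sum.inr () : R ⊕ Unit) s (fun φ hφ => (hs hφ).1)
    let g : R ⊕ Unit → R ⊕ Fin 1 := Sum.map id (fun _ => 0)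
    let θ : L.Formula R := BoundedFormula.ex (n := 0) (BoundedFormula.relabel (k := 0) g ψ)
    have hθ : IsPP θ := IsPP.ex (IsPP.relabel g hψ)
    have key : ∀ (A : Type w) [L.Structure A] (v : R → A),
        θ.Realize v ↔ ∃ c, ψ.Realize (Sum.elim v fun _ => c) := by
      intro A _ v
      simp only [θ, Formula.Realize]
      rw [BoundedFormula.realize_ex]
      refine exists_congr fun c => ?_
      refine (BoundedFormula.realize_relabel (m := 1) (n := 0)).trans ?_
      have e : (Sum.elim v ((Fin.snoc default c : Fin 1 → A) ∘ Fin.castAdd 0) ∘ g)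
          = Sum.elim v fun _ => c := by
        funext x
        rcases x with x | x
        · rfl
        · simp [g, Fin.snoc]
      rw [← e]
      exact iff_of_eq (congrArg _ (Subsingleton.elim _ _))
    obtain ⟨c, hc⟩ := (key M _).1 (h θ hθ ((key N _).2 ⟨n, (hr N _).2 fun φ hφ => (hs hφ).2⟩))
    exact ⟨c, (hr M _).1 hc⟩)
  refine ⟨m, ?_⟩
  intro φ hφ hr
  let g : (insert (n, m) R : Set (N × M)) → R ⊕ Unit :=
    fun x => if hx : x.1 ∈ R then Sum.inl ⟨x.1, hx⟩ else Sum.inr ()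
  have e1 : (Sum.elim (fun r : R => r.1.1) fun _ => n) ∘ g = fun r => r.1.1 := by
    funext x
    by_cases hx : x.1 ∈ R
    · simp [g, hx]
    · have : x.1 = (n, m) := x.2.resolve_right hx
      simp only [Function.comp, g, hx, dif_neg, not_false_eq_true, Sum.elim_inr]
      rw [this]
  have e2 : (Sum.elim (fun r : R => r.1.2) fun _ => m) ∘ g = fun r => r.1.2 := by
    funext x
    by_cases hx : x.1 ∈ R
    · simp [g, hx]
    · have : x.1 = (n, m) := x.2.resolve_right hx
      simp only [Function.comp, g, hx, dif_neg, not_false_eq_true, Sum.elim_inr]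
      rw [this]
  have := hm (φ.relabel g) ⟨IsPP.relabel _ hφ, by rw [Formula.realize_relabel, e1]; exact hr⟩
  rw [Formula.realize_relabel, e2] at this
  exact this

theorem exists_total (hsat : IsSaturated L (#M) M) (hinf : ℵ₀ ≤ #M) (hNM : #N = #M)
    (R₀ : Set (N × M)) (hfin : R₀.Finite) (h0 : PPR L R₀) :
    ∃ f : N → M, PPR L (R₀ ∪ Set.range fun x => (x, f x)) := by
  classical
  obtain ⟨_, _, hord⟩ := exists_ord_eq_type_lt N
  have : Infinite M := infinite_iff.2 hinf
  let step : (x : N) → ((y : N) → y < x → M) → M := fun x ih =>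
    if h : ∃ m, PPR L (insert (x, m) (R₀ ∪ Set.range fun y : Set.Iio x => (y.1, ih y.1 y.2)))
    then h.choose else Classical.arbitrary M
  let f : N → M := WellFounded.fix (r := (· < ·)) wellFounded_lt step
  let S : Set N → Set (N × M) := fun D => R₀ ∪ Set.image (fun x => (x, f x)) D
  have hf : ∀ x, (∃ m, PPR L (insert (x, m) (S (Set.Iio x)))) →
      PPR L (insert (x, f x) (S (Set.Iio x))) := by
    intro x hx
    have hS : S (Set.Iio x) = R₀ ∪ Set.range fun y : Set.Iio x => (y.1, f y.1) := by
      simp only [S, Set.image_eq_range]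
    have e : f x = step x (fun y _ => f y) := WellFounded.fix_eq _ _ _
    rw [hS] at hx ⊢
    have e2 : f x = hx.choose := by rw [e]; exact dif_pos hx
    rw [e2]
    exact hx.choose_spec
  have hdir : ∀ D : Set N, (∀ x ∈ D, PPR L (S (Set.Iic x))) → PPR L (S D) := by
    intro D hD
    apply PPR.of_finite
    intro F hF
    have hS : ∀ x y, x ≤ y → S (Set.Iic x) ⊆ S (Set.Iic y) := fun x y hxy =>
      Set.union_subset_union_right _ (Set.image_mono (Set.Iic_subset_Iic.2 hxy))
    have : (F : Set (N × M)) ⊆ R₀ ∨ ∃ x ∈ D, (F : Set (N × M)) ⊆ S (Set.Iic x) := by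
      induction F using Finset.induction_on with
      | empty => left; simp
      | insert q F _ ih =>
        rw [Finset.coe_insert, Set.insert_subset_iff] at hF
        rw [Finset.coe_insert]
        simp only [Set.insert_subset_iff]
        rcases hF.1 with hq | ⟨x, hx, rfl⟩
        · rcases ih hF.2 with h | ⟨y, hy, h⟩
          · exact Or.inl ⟨hq, h⟩
          · exact Or.inr ⟨y, hy, Or.inl hq, h⟩
        · right
          have hm : ∀ z, x ≤ z → (x, f x) ∈ S (Set.Iic z) := fun z hz => Or.inr ⟨x, hz, rfl⟩
          rcases ih hF.2 with h | ⟨y, hy, h⟩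
          · exact ⟨x, hx, hm x le_rfl, h.trans Set.subset_union_left⟩
          · rcases le_total x y with hxy | hxy
            · exact ⟨y, hy, hm y hxy, h⟩
            · exact ⟨x, hx, hm x le_rfl, h.trans (hS _ _ hxy)⟩
    rcases this with h | ⟨x, hx, h⟩
    · exact h0.mono h
    · exact (hD x hx).mono h
  have hall : ∀ x, PPR L (S (Set.Iic x)) := by
    intro x
    induction x using WellFoundedLT.induction with
    | ind x ih =>
    have h1 : PPR L (S (Set.Iio x)) := hdir _ ih
    have hc : #(S (Set.Iio x)) < #M := by
      refine (mk_union_le _ _).trans_lt (add_lt_of_lt hinf ?_ ?_)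
      · exact (lt_aleph0_iff_set_finite.2 hfin).trans_le hinf
      · refine mk_image_le.trans_lt ?_
        rw [← hNM]
        exact mk_Iio_lt _ hord
    refine (hf x (PPR.extend hsat hc h1 x)).mono ?_
    rintro q (hq | ⟨y, hy, rfl⟩)
    · exact Or.inr (Or.inl hq)
    · rcases (show y ≤ x from hy).lt_or_eq with h | rfl
      · exact Or.inr (Or.inr ⟨y, h, rfl⟩)
      · exact Or.inl rfl
  refine ⟨f, ?_⟩
  have := hdir Set.univ (fun x _ => hall x)
  simpa only [S, Set.image_univ] using this

end Helpers

/-- A saturated structure whose cardinality `κ` satisfies `κ = κ^ω`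
has the homomorphism lifting property. -/
theorem saturated_homLifting {L : FirstOrder.Language.{u, v}} [L.IsRelational]
    (M : Type w) [L.Structure M]
    (hsat : IsSaturated L (#M) M) (hcard : (#M) ^ (ℵ₀ : Cardinal.{w}) = #M) :
    HomLifting L M := by
  intro k a b hab
  by_cases hss : Subsingleton M
  · exact ⟨⟨fun x => x 0, fun {n} f => isEmptyElim f, fun {n} r x h => h 0⟩,
      fun i => Subsingleton.elim _ _⟩
  have hnt : Nontrivial M := not_subsingleton_iff_nontrivial.1 hss
  have hinf : ℵ₀ ≤ #M := by
    have h2 : (2 : Cardinal) ≤ #M := by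
      rw [two_le_iff]; exact exists_pair_ne M
    rw [← hcard]
    exact (cantor ℵ₀).le.trans (power_le_power_right h2)
  have hNM : #(ℕ → M) = #M := by
    rw [← hcard]; simp
  let R₀ : Set ((ℕ → M) × M) := Set.range fun i => (a i, b i)
  have h0 : PPR L R₀ := by
    intro φ hφ hr
    let g : R₀ → Fin k := fun r => r.2.choose
    have hg : ∀ r : R₀, (a (g r), b (g r)) = r.1 := fun r => r.2.choose_spec
    have := hab (φ.relabel g) (IsPP.relabel _ hφ)
    rw [Formula.realize_relabel, Formula.realize_relabel] at this
    have e1 : a ∘ g = fun r => r.1.1 := funext fun r => congrArg Prod.fst (hg r)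
    have e2 : b ∘ g = fun r => r.1.2 := funext fun r => congrArg Prod.snd (hg r)
    rw [e1, e2] at this
    exact this hr
  obtain ⟨f, hf⟩ := exists_total hsat hinf hNM R₀ (Set.finite_range _) h0
  have hmem : ∀ x, (x, f x) ∈ R₀ ∪ Set.range fun x => (x, f x) := fun x => Or.inr ⟨x, rfl⟩
  refine ⟨⟨f, fun {n} f => isEmptyElim f, ?_⟩, ?_⟩
  · intro n r x hx
    exact hf (BoundedFormula.rel r fun i => Term.var (Sum.inl ⟨(x i, f (x i)), hmem _⟩))
      (IsPP.rel _ _) hx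
  · intro i
    exact hf (BoundedFormula.equal (Term.var (Sum.inl ⟨(a i, f (a i)), hmem _⟩))
      (Term.var (Sum.inl ⟨(a i, b i), Or.inl ⟨i, rfl⟩⟩))) (IsPP.equal _ _) rfl

end PaperCSP
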